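/- arXiv:1007.1734 — 3 statements merged into one kernel-verified Lean document; each statement's English description precedes it below -/
import Mathlib

section
/- For every fixed positive integer t there exists a constant c > 0 (depending only on t) such that for every integer d ≥ max{3, t}, every finite connected d-regular simple graph G with girth greater than 2t+2 has speed-t cop number at least c·d^t. -/
open SimpleGraph

variable {V : Type*}

/-- The robber, moving with speed `t`, can move from `x` to `y` while the cops occupy
the vertices `cops i`: there is a path of length at most `t` from `x` to `y` that
does not pass through any cop-occupied vertex. -/
def RobberCanMove {k : ℕ} (G : SimpleGraph V) (t : ℕ) (cops : Fin k → V) (x y : V) : Prop :=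
  ∃ w : G.Walk x y, w.IsPath ∧ w.length ≤ t ∧ ∀ i : Fin k, cops i ∉ w.support

/-- A strategy for `k` cops on `G`: an initial placement, and a move function which,
given the current cop positions and the robber's position, tells each cop to stay
where he is or move to an adjacent vertex. -/
structure CopStrategy (G : SimpleGraph V) (k : ℕ) where
  init : Fin k → V
  move : (Fin k → V) → V → (Fin k → V)
  move_valid : ∀ c r i, move c r i = c i ∨ G.Adj (c i) (move c r i)

/-- The sequence of cop positions induced by a cop strategy against
a robber play `r : ℕ → V` (where `r n` is the robber's position in round `n`). -/
def copSeq {G : SimpleGraph V} {k : ℕ} (CS : CopStrategy G k) (r : ℕ → V) : ℕ → Fin k → V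
  | 0 => CS.init
  | n + 1 => CS.move (copSeq CS r n) (r n)

/-- A robber play `r` (with speed `t`) is valid against a cop strategy if, in each round,
the robber either has already been caught or moves along a path of length at most `t`
avoiding the (just moved) cops. -/
def ValidRobberPlay {k : ℕ} (G : SimpleGraph V) (t : ℕ) (CS : CopStrategy G k)
    (r : ℕ → V) : Prop :=
  ∀ n, RobberCanMove G t (copSeq CS r (n + 1)) (r n) (r (n + 1)) ∨
    ∃ i, copSeq CS r (n + 1) i = r n

/-- A cop strategy is winning (against a speed-`t` robber) if in every valid robber play a cop
eventually steps onto the robber's current vertex (or the robber is caught at the start). -/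
def CopsWin {k : ℕ} (G : SimpleGraph V) (t : ℕ) (CS : CopStrategy G k) : Prop :=
  ∀ r : ℕ → V, ValidRobberPlay G t CS r →
    (∃ i, copSeq CS r 0 i = r 0) ∨ ∃ n i, copSeq CS r (n + 1) i = r n

/-- The speed-`t` cop number of `G`: the least number of cops having a winning strategy. -/
noncomputable def copNumber (G : SimpleGraph V) (t : ℕ) : ℕ :=
  sInf { k | ∃ CS : CopStrategy G k, CopsWin G t CS }

namespace SimpleGraph

variable {G : SimpleGraph V}

/-- Two paths with common ends whose total length is less than the girth coincide. -/
theorem Walk.IsPath.eq_of_length_add_length_lt_girth {x y : V} {p q : G.Walk x y}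
    (hp : p.IsPath) (hq : q.IsPath) (h : p.length + q.length < G.girth) : p = q := by
  classical
  induction p with
  | nil => exact (Walk.isPath_iff_nil.1 hq).eq_nil.symm
  | @cons x u y hxu p ih =>
    cases q with
    | nil => simp at hp
    | @cons _ w _ hxw q =>
      rw [Walk.cons_isPath_iff] at hp
      by_cases huw : u = w
      · subst huw
        rw [Walk.cons_isPath_iff] at hq
        simp only [Walk.length_cons] at h
        rw [ih hp.1 hq.1 (by lia)]
      · exfalso
        have hq' := hq
        rw [Walk.cons_isPath_iff] at hq
        let r : G.Walk u x := (p.append (Walk.cons hxw q).reverse).bypass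
        have hr : s(x, u) ∉ r.edges := by
          intro hmem
          have := Walk.edges_bypass_subset_edges _ hmem
          rw [Walk.edges_append, Walk.edges_reverse, List.mem_append, List.mem_reverse,
            Walk.edges_cons, List.mem_cons] at this
          rcases this with h1 | h1 | h1
          · exact hp.2 (Walk.fst_mem_support_of_mem_edges _ h1)
          · rcases Sym2.eq_iff.1 h1 with h2 | h2
            · exact huw h2.2
            · exact hxw.ne h2.1
          · exact hq.2 (Walk.fst_mem_support_of_mem_edges _ h1)
        have hcyc : (Walk.cons hxu r).IsCycle :=
          (Walk.cons_isCycle_iff _ _).2 ⟨Walk.bypass_isPath _, hr⟩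
        have h1 := girth_le_length hcyc
        have h2 := Walk.length_bypass_le_length (p.append (Walk.cons hxw q).reverse)
        simp only [Walk.length_cons, Walk.length_append, Walk.length_reverse, r] at h h1 h2
        lia

theorem Connected.dist_le_dist_add_one_of_adj (hG : G.Connected) {u v : V} (r : V)
    (h : G.Adj u v) : G.dist r v ≤ G.dist r u + 1 := by
  have h1 := hG.dist_triangle (u := r) (v := u) (w := v)
  rwa [dist_eq_one_iff_adj.2 h] at h1

/-- A vertex on a geodesic from `x` to `y` splits the distance. -/
theorem Walk.dist_add_dist_of_mem_support {x y z : V} (p : G.Walk x y)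
    (hp : p.length = G.dist x y) (hG : G.Connected) (hz : z ∈ p.support) :
    G.dist x z + G.dist z y = G.dist x y := by
  classical
  have h1 := congrArg Walk.length (p.take_spec hz)
  rw [Walk.length_append] at h1
  have h2 := dist_le (p.takeUntil z hz)
  have h3 := dist_le (p.dropUntil z hz)
  have h4 := hG.dist_triangle (u := x) (v := z) (w := y)
  lia

/-- Below the girth, a vertex `u` has at most one neighbour `v` that is not farther
from `r` than `u` is. -/
theorem Connected.eq_of_adj_of_dist_ne (hG : G.Connected) {r u v w : V}
    (huv : G.Adj u v) (huw : G.Adj u w) (hv : G.dist r v ≠ G.dist r u + 1)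
    (hw : G.dist r w ≠ G.dist r u + 1) (hlt : G.dist r v + G.dist r w + 2 < G.girth) :
    v = w := by
  obtain ⟨p, hp, hpl⟩ := hG.exists_path_of_dist r v
  obtain ⟨q, hq, hql⟩ := hG.exists_path_of_dist r w
  have hpu : u ∉ p.support := fun h => hv <| by
    rw [← p.dist_add_dist_of_mem_support hpl hG h, dist_eq_one_iff_adj.2 huv]
  have hqu : u ∉ q.support := fun h => hw <| by
    rw [← q.dist_add_dist_of_mem_support hql hG h, dist_eq_one_iff_adj.2 huw]
  have := (hp.concat hpu huv.symm).eq_of_length_add_length_lt_girth (hq.concat hqu huw.symm)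
    (by simp only [Walk.length_concat]; lia)
  exact (Walk.concat_inj this).1

theorem Connected.exists_adj_dist_eq (hG : G.Connected) {x v : V} {j : ℕ}
    (h : G.dist x v = j + 1) : ∃ u, G.Adj u v ∧ G.dist x u = j := by
  obtain ⟨p, hp⟩ := hG.exists_walk_length_eq_dist v x
  rw [dist_comm, h] at hp
  cases p with
  | nil => simp at hp
  | @cons _ u _ hvu p =>
    refine ⟨u, hvu.symm, ?_⟩
    have h1 := dist_le p
    have h2 := hG.dist_le_dist_add_one_of_adj x hvu.symm
    rw [dist_comm] at h1
    simp only [Walk.length_cons] at hp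
    lia

section Spheres

variable [Fintype V]

/-- The vertices at distance `j` from `x`. -/
noncomputable def sphere (G : SimpleGraph V) (x : V) (j : ℕ) : Finset V := by
  classical exact {v | G.dist x v = j}

@[simp]
theorem mem_sphere {x v : V} {j : ℕ} : v ∈ G.sphere x j ↔ G.dist x v = j := by
  simp [sphere]

variable [DecidableRel G.Adj] {d : ℕ}

theorem Connected.card_sphere_le (hG : G.Connected) (hd : G.IsRegularOfDegree d) (x : V) (j : ℕ) :
    (G.sphere x j).card ≤ d ^ j := by
  classical
  induction j with
  | zero =>
    have : G.sphere x 0 ⊆ {x} := fun v hv => by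
      rw [mem_sphere, hG.dist_eq_zero_iff] at hv
      simp [hv]
    simpa using Finset.card_le_card this
  | succ j ih =>
    have : G.sphere x (j + 1) ⊆ (G.sphere x j).biUnion fun u => G.neighborFinset u := by
      intro v hv
      obtain ⟨u, huv, hu⟩ := hG.exists_adj_dist_eq (mem_sphere.1 hv)
      exact Finset.mem_biUnion.2 ⟨u, by simpa using hu, by simpa using huv⟩
    calc _ ≤ _ := Finset.card_le_card this
      _ ≤ (G.sphere x j).card * d := Finset.card_biUnion_le_card_mul _ _ _ fun u _ => (hd u).le
      _ ≤ d ^ j * d := Nat.mul_le_mul_right _ ih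
      _ = d ^ (j + 1) := (pow_succ _ _).symm

theorem Connected.card_sphere_ge (hG : G.Connected) (hd : G.IsRegularOfDegree d) (x : V) {j : ℕ}
    (hj : 2 * j < G.girth) : (d - 1) ^ j ≤ (G.sphere x j).card := by
  classical
  induction j with
  | zero =>
    have : x ∈ G.sphere x 0 := by simp
    simpa using Finset.card_pos.2 ⟨x, this⟩
  | succ j ih =>
    have key : (G.sphere x j).card * (d - 1) ≤ (G.sphere x (j + 1)).card * 1 := by
      refine Finset.card_mul_le_card_mul G.Adj (fun u hu => ?_) (fun w hw => ?_)
      · rw [mem_sphere] at hu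
        have hsplit := Finset.card_filter_add_card_filter_not (s := G.neighborFinset u)
          (fun w => G.dist x w = j + 1)
        have hone : ((G.neighborFinset u).filter fun w => ¬ G.dist x w = j + 1).card ≤ 1 := by
          refine Finset.card_le_one.2 fun a ha b hb => ?_
          simp only [Finset.mem_filter, mem_neighborFinset] at ha hb
          have h1 := hG.dist_le_dist_add_one_of_adj x ha.1
          have h2 := hG.dist_le_dist_add_one_of_adj x hb.1
          exact hG.eq_of_adj_of_dist_ne (r := x) ha.1 hb.1 (by lia) (by lia) (by lia)
        have hsub : (G.neighborFinset u).filter (fun w => G.dist x w = j + 1) ⊆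
            Finset.bipartiteAbove G.Adj (G.sphere x (j + 1)) u := fun w hw => by
          simpa [Finset.mem_bipartiteAbove, and_comm] using hw
        have := Finset.card_le_card hsub
        rw [card_neighborFinset_eq_degree, hd u] at hsplit
        lia
      · rw [mem_sphere] at hw
        refine Finset.card_le_one.2 fun a ha b hb => ?_
        simp only [Finset.mem_bipartiteBelow, mem_sphere] at ha hb
        exact hG.eq_of_adj_of_dist_ne (r := x) ha.2.symm hb.2.symm (by lia) (by lia) (by lia)
    calc (d - 1) ^ (j + 1) = (d - 1) ^ j * (d - 1) := pow_succ _ _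
      _ ≤ (G.sphere x j).card * (d - 1) := Nat.mul_le_mul_right _ (ih (by lia))
      _ ≤ _ := by simpa using key

/-- Few vertices at distance `m` from `r` and `j` from `c` are not separated from `r` by `c`. -/
theorem Connected.card_filter_sphere_le (hG : G.Connected) (hd : G.IsRegularOfDegree d)
    (r c : V) {j m : ℕ} (hjm : j ≤ m) (hm : 2 * m + 2 < G.girth) :
    ((G.sphere r m).filter fun v => G.dist c v = j ∧ G.dist r c + j ≠ m).card * d
      ≤ j * d ^ j := by
  classical
  induction j generalizing m with
  | zero =>
    rw [Finset.filter_false_of_mem]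
    · simp
    · rintro v hv ⟨h1, h2⟩
      rw [hG.dist_eq_zero_iff] at h1
      exact h2 (by simpa [h1] using hv)
  | succ j ih =>
    obtain ⟨m, rfl⟩ : ∃ n, m = n + 1 := ⟨m - 1, by lia⟩
    specialize ih (m := m) (by lia) (by lia)
    set A := (G.sphere r m).filter fun v => G.dist c v = j ∧ G.dist r c + j ≠ m
    have hsub : ((G.sphere r (m + 1)).filter fun v =>
        G.dist c v = j + 1 ∧ G.dist r c + (j + 1) ≠ m + 1) ⊆
        (A.biUnion fun u => G.neighborFinset u) ∪ (G.sphere c j).biUnion fun u =>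
          (G.neighborFinset u).filter fun v => G.dist r v = m + 1 ∧ G.dist r u ≠ m := by
      intro v hv
      simp only [Finset.mem_filter, mem_sphere] at hv
      obtain ⟨u, huv, hu⟩ := hG.exists_adj_dist_eq hv.2.1
      simp only [Finset.mem_union, Finset.mem_biUnion, Finset.mem_filter, mem_sphere,
        mem_neighborFinset, A]
      by_cases hum : G.dist r u = m
      · exact .inl ⟨u, ⟨hum, hu, by lia⟩, huv⟩
      · exact .inr ⟨u, hu, huv, hv.1, hum⟩
    have h1 : (A.biUnion fun u => G.neighborFinset u).card ≤ A.card * d :=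
      Finset.card_biUnion_le_card_mul _ _ _ fun u _ => (hd u).le
    have h2 : ((G.sphere c j).biUnion fun u =>
        (G.neighborFinset u).filter fun v => G.dist r v = m + 1 ∧ G.dist r u ≠ m).card
        ≤ (G.sphere c j).card * 1 := by
      refine Finset.card_biUnion_le_card_mul _ _ _ fun u _ => Finset.card_le_one.2 ?_
      intro a ha b hb
      simp only [Finset.mem_filter, mem_neighborFinset] at ha hb
      exact hG.eq_of_adj_of_dist_ne (r := r) ha.1 hb.1 (by lia) (by lia) (by lia)
    have h3 := hG.card_sphere_le hd c j
    have h4 := (Finset.card_le_card hsub).trans (Finset.card_union_le _ _)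
    calc _ ≤ (j * d ^ j + d ^ j) * d := Nat.mul_le_mul_right _ (by lia)
      _ = _ := by ring

end Spheres

end SimpleGraph

namespace SimpleGraph

variable {G : SimpleGraph V}

theorem sum_pow_dist_le (U : Finset V) (c : V) (t : ℕ) {q : ℝ} (hq : 0 ≤ q) (hq1 : q ≤ 1) :
    ∑ v ∈ U, q ^ G.dist c v ≤
      ∑ j ∈ Finset.range (t + 1), ((U.filter fun v => G.dist c v = j).card : ℝ) * q ^ j
        + (U.card : ℝ) * q ^ (t + 1) := by
  classical
  have hpt : ∀ v, q ^ G.dist c v ≤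
      (∑ j ∈ Finset.range (t + 1), if G.dist c v = j then q ^ j else 0) + q ^ (t + 1) := by
    intro v
    rw [Finset.sum_ite_eq]
    split_ifs with h
    · exact le_add_of_nonneg_right (by positivity)
    · rw [zero_add]
      exact pow_le_pow_of_le_one hq hq1 (by simpa using h)
  refine (Finset.sum_le_sum fun v _ => hpt v).trans_eq ?_
  rw [Finset.sum_add_distrib, Finset.sum_comm, Finset.sum_const, nsmul_eq_mul]
  congr 1
  refine Finset.sum_congr rfl fun j _ => ?_
  rw [← Finset.sum_filter, Finset.sum_const, nsmul_eq_mul]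

variable [Fintype V] [DecidableRel G.Adj] {d : ℕ}

theorem Connected.half_pow_mul_pow_le_card_sphere (hG : G.Connected)
    (hd : G.IsRegularOfDegree d) (h2 : 2 ≤ d) (x : V) {j : ℕ} (hj : 2 * j < G.girth) :
    (1 / 2 : ℝ) ^ j * (d : ℝ) ^ j ≤ (G.sphere x j).card := by
  have h := hG.card_sphere_ge hd x hj
  have h' : ((d - 1 : ℕ) : ℝ) ^ j ≤ (G.sphere x j).card := by exact_mod_cast h
  refine le_trans ?_ h'
  rw [← mul_pow]
  have hd2 : (2 : ℝ) ≤ d := by exact_mod_cast h2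
  refine pow_le_pow_left₀ (by positivity) ?_ _
  rw [Nat.cast_sub (by lia)]
  push_cast
  linarith

theorem Connected.sum_unseparated_le (hG : G.Connected) (hd : G.IsRegularOfDegree d)
    (h0 : 0 < d) {t : ℕ} (ht : 2 * t + 2 < G.girth) (r c : V) {U : Finset V}
    (hU : U ⊆ G.sphere r t) (hc : ∀ v ∈ U, G.dist r c + G.dist c v ≠ t) :
    ∑ v ∈ U, ((d : ℝ)⁻¹) ^ G.dist c v ≤ (d : ℝ)⁻¹ * ((t : ℝ) + 1) ^ 2 := by
  classical
  have hd1 : (1 : ℝ) ≤ d := by exact_mod_cast h0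
  have hdpos : (0 : ℝ) < d := by linarith
  refine (sum_pow_dist_le U c t (by positivity) (inv_le_one_of_one_le₀ hd1)).trans ?_
  have h1 : ∀ j ∈ Finset.range (t + 1),
      ((U.filter fun v => G.dist c v = j).card : ℝ) * (d : ℝ)⁻¹ ^ j ≤ t * (d : ℝ)⁻¹ := by
    intro j hj
    have hjt : j ≤ t := by simpa [Nat.lt_succ_iff] using hj
    have hsub : (U.filter fun v => G.dist c v = j) ⊆
        (G.sphere r t).filter fun v => G.dist c v = j ∧ G.dist r c + j ≠ t := by
      intro v hv
      rw [Finset.mem_filter] at hv ⊢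
      exact ⟨hU hv.1, hv.2, hv.2 ▸ hc v hv.1⟩
    have hcard := (Nat.mul_le_mul_right d (Finset.card_le_card hsub)).trans
      (hG.card_filter_sphere_le hd r c hjt ht)
    have hcard' : ((U.filter fun v => G.dist c v = j).card : ℝ) * d ≤ t * (d : ℝ) ^ j := by
      exact_mod_cast hcard.trans (Nat.mul_le_mul_right _ hjt)
    rw [inv_pow, ← div_eq_mul_inv, ← div_eq_mul_inv, div_le_div_iff₀ (by positivity) hdpos]
    exact hcard'
  have h2 : (U.card : ℝ) * (d : ℝ)⁻¹ ^ (t + 1) ≤ (d : ℝ)⁻¹ := by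
    have : (U.card : ℝ) ≤ (d : ℝ) ^ t := by
      exact_mod_cast (Finset.card_le_card hU).trans (hG.card_sphere_le hd r t)
    calc _ ≤ (d : ℝ) ^ t * (d : ℝ)⁻¹ ^ (t + 1) := by gcongr
      _ = _ := by rw [pow_succ, ← mul_assoc, ← mul_pow, mul_inv_cancel₀ hdpos.ne']; simp
  have h3 := Finset.sum_le_sum h1
  rw [Finset.sum_const, Finset.card_range, nsmul_eq_mul] at h3
  push_cast at h3
  have : (0 : ℝ) ≤ (d : ℝ)⁻¹ * t := by positivity
  nlinarith

theorem Connected.card_separated_le (hG : G.Connected) (hd : G.IsRegularOfDegree d)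
    (h0 : 0 < d) (r c : V) (t : ℕ) :
    (((G.sphere r t).filter fun v => G.dist r c + G.dist c v = t).card : ℝ) ≤
      (d : ℝ) ^ t * (d : ℝ)⁻¹ ^ G.dist c r := by
  have hdpos : (0 : ℝ) < d := by exact_mod_cast h0
  rw [dist_comm (u := c) (v := r)]
  by_cases h : G.dist r c ≤ t
  · have hsub : ((G.sphere r t).filter fun v => G.dist r c + G.dist c v = t) ⊆
        G.sphere c (t - G.dist r c) := by
      intro v hv
      rw [Finset.mem_filter] at hv
      rw [mem_sphere]
      lia
    have hcard := (Finset.card_le_card hsub).trans (hG.card_sphere_le hd c _)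
    have hcard' : (((G.sphere r t).filter fun v => G.dist r c + G.dist c v = t).card : ℝ) ≤
      (d : ℝ) ^ (t - G.dist r c) := by exact_mod_cast hcard
    rwa [pow_sub₀ _ hdpos.ne' h, ← inv_pow] at hcard'
  · rw [Finset.filter_false_of_mem fun v _ hv => by lia]
    simp only [Finset.card_empty, Nat.cast_zero]
    positivity

end SimpleGraph

/-- The threat posed by the cops to a robber at `v`: a cop at distance `j` contributes `q ^ j`. -/
noncomputable def threat {k : ℕ} (G : SimpleGraph V) (q : ℝ) (cops : Fin k → V) (v : V) : ℝ :=
  ∑ i, q ^ G.dist (cops i) v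

section Robber

variable [Fintype V] {G : SimpleGraph V} [DecidableRel G.Adj] {d t k : ℕ}

/-- Against few cops, there is a starting vertex under little threat. -/
theorem exists_threat_lt (hG : G.Connected) (hd : G.IsRegularOfDegree d) (h2 : 2 ≤ d)
    (ht : 2 * t + 2 < G.girth)
    (hk : (k : ℝ) * (8 * ((t : ℝ) + 1) ^ 2) < ((1 / 2 : ℝ) ^ t) ^ 2 * (d : ℝ) ^ t)
    (cops : Fin k → V) :
    ∃ v, threat G (d : ℝ)⁻¹ cops v < (1 / 2 : ℝ) ^ t / 2 * (d : ℝ)⁻¹ := by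
  classical
  by_contra! hcon
  have hd1 : (1 : ℝ) ≤ d := by exact_mod_cast (by lia : 1 ≤ d)
  have hdpos : (0 : ℝ) < d := by linarith
  have hone : ∀ i, ∑ v, (d : ℝ)⁻¹ ^ G.dist (cops i) v ≤
      ((t : ℝ) + 1) + (Fintype.card V : ℝ) * (d : ℝ)⁻¹ ^ (t + 1) := by
    intro i
    refine (G.sum_pow_dist_le Finset.univ (cops i) t (by positivity)
      (inv_le_one_of_one_le₀ hd1)).trans ?_
    rw [Finset.card_univ]
    gcongr
    have : ∀ j ∈ Finset.range (t + 1),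
        ((Finset.univ.filter fun v => G.dist (cops i) v = j).card : ℝ) * (d : ℝ)⁻¹ ^ j ≤ 1 := by
      intro j _
      have hs : (Finset.univ.filter fun v => G.dist (cops i) v = j) = G.sphere (cops i) j := by
        ext v; simp
      have : ((G.sphere (cops i) j).card : ℝ) ≤ (d : ℝ) ^ j := by
        exact_mod_cast hG.card_sphere_le hd _ _
      rw [hs, inv_pow, ← div_eq_mul_inv]
      exact div_le_one_of_le₀ this (by positivity)
    simpa using Finset.sum_le_sum this
  have hsum : (Fintype.card V : ℝ) * ((1 / 2 : ℝ) ^ t / 2 * (d : ℝ)⁻¹) ≤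
      k * (((t : ℝ) + 1) + (Fintype.card V : ℝ) * (d : ℝ)⁻¹ ^ (t + 1)) := by
    calc _ = ∑ _v : V, ((1 / 2 : ℝ) ^ t / 2 * (d : ℝ)⁻¹) := by simp
      _ ≤ ∑ v, threat G (d : ℝ)⁻¹ cops v := Finset.sum_le_sum fun v _ => hcon v
      _ = ∑ i, ∑ v, (d : ℝ)⁻¹ ^ G.dist (cops i) v := Finset.sum_comm
      _ ≤ ∑ _i : Fin k, (((t : ℝ) + 1) + (Fintype.card V : ℝ) * (d : ℝ)⁻¹ ^ (t + 1)) :=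
        Finset.sum_le_sum fun i _ => hone i
      _ = _ := by rw [Finset.sum_const, Finset.card_univ, Fintype.card_fin, nsmul_eq_mul]
  obtain ⟨x⟩ := hG.nonempty
  have hV : (1 / 2 : ℝ) ^ (t + 1) * (d : ℝ) ^ (t + 1) ≤ Fintype.card V :=
    (hG.half_pow_mul_pow_le_card_sphere hd h2 x (by lia)).trans
      (by exact_mod_cast Finset.card_le_univ _)
  set n : ℝ := (Fintype.card V : ℝ)
  set L : ℝ := (1 / 2 : ℝ) ^ t with hL
  have hLpos : 0 < L := by positivity
  have hL1 : L ≤ 1 := pow_le_one₀ (by norm_num) (by norm_num)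
  set D : ℝ := (d : ℝ) ^ t with hD
  have hDpos : 0 < D := by positivity
  obtain ⟨M, hM⟩ : ∃ M : ℝ, n = M * (D * d) := ⟨n / (D * d), by field_simp⟩
  obtain ⟨K, hK⟩ : ∃ K : ℝ, (k : ℝ) = K * D := ⟨k / D, by field_simp⟩
  have hK0 : 0 ≤ K := by
    by_contra! h
    have : (k : ℝ) < 0 := hK ▸ mul_neg_of_neg_of_pos h hDpos
    exact absurd this (by simp)
  have hM0 : L / 2 ≤ M := by
    rw [hM, pow_succ, pow_succ, ← hL, ← hD] at hV
    refine le_of_mul_le_mul_right ?_ (show 0 < D * d by positivity)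
    linarith
  have hmain : M * (L / 2) ≤ K * (t + 1) + K * M := by
    rw [hM, hK, pow_succ, inv_pow, ← hD] at hsum
    have e1 : M * (D * d) * (L / 2 * (d : ℝ)⁻¹) = M * (L / 2) * D := by field_simp
    have e2 : K * D * (↑t + 1 + M * (D * ↑d) * (D⁻¹ * (↑d)⁻¹)) = (K * (t + 1) + K * M) * D := by
      field_simp
    rw [e1, e2] at hsum
    exact le_of_mul_le_mul_right hsum hDpos
  have hk' : K * (8 * ((t : ℝ) + 1) ^ 2) < L ^ 2 := by
    rw [hK] at hk
    refine lt_of_mul_lt_mul_right ?_ hDpos.le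
    linarith
  have ht0 : (0 : ℝ) ≤ t := by positivity
  have hKt : K * (8 * (t + 1)) < L ^ 2 := by
    nlinarith [mul_nonneg hK0 ht0, mul_nonneg hK0 (mul_nonneg ht0 ht0)]
  have hK8 : K * 8 < L ^ 2 := by nlinarith [mul_nonneg hK0 ht0]
  have hKL : K < L / 8 := by nlinarith
  nlinarith [mul_le_mul_of_nonneg_right hM0 (by linarith : 0 ≤ L / 2 - K)]

/-- A robber under little threat survives the cops' move and can reach another such vertex. -/
theorem exists_robberCanMove_threat_lt (hG : G.Connected) (hd : G.IsRegularOfDegree d)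
    (h2 : 2 ≤ d) (ht : 2 * t + 2 < G.girth)
    (hk : (k : ℝ) * (8 * ((t : ℝ) + 1) ^ 2) < ((1 / 2 : ℝ) ^ t) ^ 2 * (d : ℝ) ^ t)
    {cops cops' : Fin k → V} (hmove : ∀ i, cops' i = cops i ∨ G.Adj (cops i) (cops' i)) {r : V}
    (hr : threat G (d : ℝ)⁻¹ cops r < (1 / 2 : ℝ) ^ t / 2 * (d : ℝ)⁻¹) :
    (∀ i, cops' i ≠ r) ∧ ∃ v, RobberCanMove G t cops' r v ∧
      threat G (d : ℝ)⁻¹ cops' v < (1 / 2 : ℝ) ^ t / 2 * (d : ℝ)⁻¹ := by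
  classical
  have hd1 : (1 : ℝ) ≤ d := by exact_mod_cast (by lia : 1 ≤ d)
  have hdpos : (0 : ℝ) < d := by linarith
  have hq1 : (d : ℝ)⁻¹ ≤ 1 := inv_le_one_of_one_le₀ hd1
  set q : ℝ := (d : ℝ)⁻¹ with hq
  have hqpos : 0 < q := by positivity
  set L : ℝ := (1 / 2 : ℝ) ^ t with hL
  have hLpos : 0 < L := by positivity
  have hL1 : L ≤ 1 := pow_le_one₀ (by norm_num) (by norm_num)
  have hnear : ∀ i, G.dist (cops i) r ≤ G.dist (cops' i) r + 1 := by
    intro i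
    rcases hmove i with h | h
    · rw [h]; lia
    · rw [dist_comm, dist_comm (u := cops' i)]
      exact hG.dist_le_dist_add_one_of_adj r h.symm
  refine ⟨fun i hi => ?_, ?_⟩
  · have h1 : G.dist (cops i) r ≤ 1 := by simpa [hi] using hnear i
    have h3 : q ^ G.dist (cops i) r ≤ threat G q cops r :=
      Finset.single_le_sum (f := fun i => q ^ G.dist (cops i) r)
        (fun _ _ => by positivity) (Finset.mem_univ i)
    have h4 : q ^ 1 ≤ q ^ G.dist (cops i) r := pow_le_pow_of_le_one hqpos.le hq1 h1
    nlinarith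
  · have hthreat : threat G q cops' r * q ≤ threat G q cops r := by
      rw [threat, threat, Finset.sum_mul]
      refine Finset.sum_le_sum fun i _ => ?_
      rw [← pow_succ]
      exact pow_le_pow_of_le_one hqpos.le hq1 (hnear i)
    have hthreat' : threat G q cops' r < L / 2 :=
      lt_of_mul_lt_mul_right (hthreat.trans_lt hr) hqpos.le
    set B : Fin k → Finset V := fun i =>
      (G.sphere r t).filter fun v => G.dist r (cops' i) + G.dist (cops' i) v = t with hB
    set U : Finset V := G.sphere r t \ Finset.univ.biUnion B with hU
    have hUmem : ∀ v ∈ U, G.dist r v = t ∧ ∀ i, G.dist r (cops' i) + G.dist (cops' i) v ≠ t := by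
      intro v hv
      simp only [hU, hB, Finset.mem_sdiff, Finset.mem_biUnion, Finset.mem_univ, true_and,
        Finset.mem_filter, SimpleGraph.mem_sphere, not_exists, not_and] at hv
      exact ⟨hv.1, fun i => hv.2 i hv.1⟩
    have hcard : L / 2 * (d : ℝ) ^ t ≤ U.card := by
      have h1 : (G.sphere r t).card ≤ U.card + ∑ i, (B i).card :=
        (Finset.card_le_card_sdiff_add_card (t := Finset.univ.biUnion B)).trans
          (Nat.add_le_add_left Finset.card_biUnion_le _)
      have h1' : ((G.sphere r t).card : ℝ) ≤ U.card + ∑ i, ((B i).card : ℝ) := by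
        exact_mod_cast h1
      have h3 : ∑ i, ((B i).card : ℝ) ≤ (d : ℝ) ^ t * threat G q cops' r := by
        rw [threat, Finset.mul_sum]
        exact Finset.sum_le_sum fun i _ => hG.card_separated_le hd (by lia) r (cops' i) t
      have h4 : L * (d : ℝ) ^ t ≤ (G.sphere r t).card :=
        hG.half_pow_mul_pow_le_card_sphere hd h2 r (by lia)
      have h5 : (0 : ℝ) < (d : ℝ) ^ t := by positivity
      nlinarith
    have hsum : ∑ v ∈ U, threat G q cops' v ≤ k * (q * ((t : ℝ) + 1) ^ 2) := by
      calc _ = ∑ i, ∑ v ∈ U, q ^ G.dist (cops' i) v := Finset.sum_comm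
        _ ≤ ∑ _i : Fin k, q * ((t : ℝ) + 1) ^ 2 := Finset.sum_le_sum fun i _ =>
          hG.sum_unseparated_le hd (by lia) ht r (cops' i) Finset.sdiff_subset
            fun v hv => (hUmem v hv).2 i
        _ = _ := by simp
    obtain ⟨v, hvU, hv⟩ : ∃ v ∈ U, threat G q cops' v < L / 2 * q := by
      by_contra! hcon
      have h1 := Finset.card_nsmul_le_sum U _ _ hcon
      rw [nsmul_eq_mul] at h1
      have h3 : (U.card : ℝ) * (L / 2) ≤ k * ((t : ℝ) + 1) ^ 2 := by
        refine le_of_mul_le_mul_right ?_ hqpos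
        linarith
      have h4 : 0 < L ^ 2 * (d : ℝ) ^ t := by positivity
      nlinarith [mul_le_mul_of_nonneg_right hcard (by positivity : 0 ≤ L / 2)]
    obtain ⟨hvt, hvc⟩ := hUmem v hvU
    obtain ⟨p, hp, hpl⟩ := hG.exists_path_of_dist r v
    refine ⟨v, ⟨p, hp, by lia, fun i hi => hvc i ?_⟩, hv⟩
    rw [p.dist_add_dist_of_mem_support hpl hG hi, hvt]

theorem not_copsWin (hG : G.Connected) (hd : G.IsRegularOfDegree d)
    (h2 : 2 ≤ d) (ht : 2 * t + 2 < G.girth)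
    (hk : (k : ℝ) * (8 * ((t : ℝ) + 1) ^ 2) < ((1 / 2 : ℝ) ^ t) ^ 2 * (d : ℝ) ^ t)
    (CS : CopStrategy G k) : ¬ CopsWin G t CS := by
  let Safe (s : (Fin k → V) × V) : Prop :=
    threat G (d : ℝ)⁻¹ s.1 s.2 < (1 / 2 : ℝ) ^ t / 2 * (d : ℝ)⁻¹
  obtain ⟨v₀, hv₀⟩ := exists_threat_lt hG hd h2 ht hk CS.init
  have hstep := fun s : {s // Safe s} =>
    exists_robberCanMove_threat_lt hG hd h2 ht hk (CS.move_valid s.1.1 s.1.2) s.2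
  choose hfree next hnext hsafe using hstep
  let state : ℕ → {s // Safe s} := fun n => Nat.rec ⟨(CS.init, v₀), hv₀⟩
    (fun _ s => ⟨(CS.move s.1.1 s.1.2, next s), hsafe s⟩) n
  let r : ℕ → V := fun n => (state n).1.2
  have hseq : ∀ n, copSeq CS r n = (state n).1.1 := by
    intro n
    induction n with
    | zero => rfl
    | succ n ih => rw [copSeq, ih]
  have hseq' : ∀ n, copSeq CS r (n + 1) = CS.move (state n).1.1 (state n).1.2 :=
    fun n => hseq (n + 1)
  have hvalid : ValidRobberPlay G t CS r := by
    intro n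
    rw [hseq' n]
    exact .inl (hnext (state n))
  intro hwin
  rcases hwin r hvalid with ⟨i, hi⟩ | ⟨n, i, hi⟩
  · have hpos : (0 : ℝ) < (d : ℝ)⁻¹ := by
      have : 0 < d := by lia
      positivity
    have h1 : (1 : ℝ) ≤ threat G (d : ℝ)⁻¹ CS.init v₀ := by
      have h3 : (d : ℝ)⁻¹ ^ G.dist (CS.init i) v₀ ≤ threat G (d : ℝ)⁻¹ CS.init v₀ :=
        Finset.single_le_sum (f := fun i => (d : ℝ)⁻¹ ^ G.dist (CS.init i) v₀)
          (fun _ _ => by positivity) (Finset.mem_univ i)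
      have hi' : CS.init i = v₀ := hi
      simpa [hi'] using h3
    have hL1 : (1 / 2 : ℝ) ^ t ≤ 1 := pow_le_one₀ (by norm_num) (by norm_num)
    have hd1 : (d : ℝ)⁻¹ ≤ 1 := inv_le_one_of_one_le₀ (by exact_mod_cast (by lia : 1 ≤ d))
    have h4 : (1 / 2 : ℝ) ^ t / 2 * (d : ℝ)⁻¹ < 1 := by nlinarith
    exact absurd (h1.trans_lt hv₀) (by linarith)
  · rw [hseq' n] at hi
    exact hfree (state n) i hi

end Robber

/-- One cop on every vertex wins at once. -/
theorem exists_copsWin [Fintype V] (G : SimpleGraph V) (t : ℕ) :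
    ∃ k, ∃ CS : CopStrategy G k, CopsWin G t CS :=
  ⟨Fintype.card V, ⟨(Fintype.equivFin V).symm, fun c _ => c, fun _ _ _ => .inl rfl⟩,
    fun r _ => .inl ⟨Fintype.equivFin V (r 0), by simp [copSeq]⟩⟩

/-- For every fixed positive integer `t` there is a constant `c > 0` such that
every finite connected `d`-regular graph with `d ≥ max 3 t` and girth greater than `2t+2`
has speed-`t` cop number at least `c·d^t`. -/
theorem stmt1 (t : ℕ) (ht : 0 < t) :
    ∃ c : ℝ, 0 < c ∧
      ∀ (d : ℕ), max 3 t ≤ d →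
        ∀ (V : Type) [Fintype V] (G : SimpleGraph V) [DecidableRel G.Adj],
          G.Connected → G.IsRegularOfDegree d → (2 * t + 2 : ℕ∞) < G.girth →
            c * (d : ℝ) ^ t ≤ (copNumber G t : ℝ) := by
  refine ⟨((1 / 2 : ℝ) ^ t) ^ 2 / (8 * ((t : ℝ) + 1) ^ 2), by positivity, ?_⟩
  intro d hd V _ G _ hG hreg hgirth
  have hgirth' : 2 * t + 2 < G.girth := by exact_mod_cast hgirth
  by_contra! hlt
  obtain ⟨CS, hCS⟩ := Nat.sInf_mem (exists_copsWin G t)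
  refine not_copsWin hG hreg (by lia) hgirth' ?_ CS hCS
  rwa [div_mul_eq_mul_div, lt_div_iff₀ (by positivity)] at hlt
end

section
/- Let t ≥ 2 be a fixed integer denoting the speed of the robber. There exists a constant c > 0 such that for every integer n ≥ 54 there exists a connected simple graph G on exactly n vertices whose speed-t cop number is at least c·n^{2/3}. -/
open SimpleGraph

variable {V : Type*}

/-! ### Evading cops by an invariant -/

/-- A speed-`t` robber, `t ≥ 2`, escapes `k` cops if she can maintain an invariant by
moving along paths of length two. -/
theorem not_copsWin_of_invariant {k t : ℕ} (ht : 2 ≤ t) {G : SimpleGraph V}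
    (Inv : (Fin k → V) → V → Prop)
    (start : ∀ c, ∃ v, Inv c v)
    (notCaught : ∀ c v, Inv c v → ∀ i, c i ≠ v)
    (step : ∀ c c' v, Inv c v → (∀ i, c' i = c i ∨ G.Adj (c i) (c' i)) →
      (∀ i, c' i ≠ v) ∧ ∃ l u, G.Adj v l ∧ G.Adj l u ∧ v ≠ u ∧ (∀ i, c' i ≠ l) ∧ Inv c' u)
    (CS : CopStrategy G k) : ¬ CopsWin G t CS := by
  intro hwin
  have next : ∀ s : {s : (Fin k → V) × V // Inv s.1 s.2},
      ∃ u, Inv (CS.move s.1.1 s.1.2) u ∧ (∀ i, CS.move s.1.1 s.1.2 i ≠ s.1.2) ∧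
        RobberCanMove G t (CS.move s.1.1 s.1.2) s.1.2 u := by
    rintro ⟨⟨c, v⟩, hs⟩
    obtain ⟨hv, l, u, hvl, hlu, hvu, hl, hu⟩ := step c (CS.move c v) v hs (CS.move_valid c v)
    refine ⟨u, hu, hv, Walk.cons hvl (Walk.cons hlu Walk.nil), ?_, by simpa using ht, ?_⟩
    · simp [Walk.isPath_def, hvl.ne, hlu.ne, hvu]
    · intro i
      simp [hv i, hl i, notCaught _ _ hu i]
  choose f hInv hfree hmove using next
  obtain ⟨v₀, hv₀⟩ := start CS.init
  let s : ℕ → {s : (Fin k → V) × V // Inv s.1 s.2} := fun n =>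
    Nat.rec ⟨(CS.init, v₀), hv₀⟩ (fun _ s => ⟨(CS.move s.1.1 s.1.2, f s), hInv s⟩) n
  have hseq : ∀ n, copSeq CS (fun n => (s n).1.2) n = (s n).1.1 := by
    intro n
    induction n with
    | zero => rfl
    | succ n ih => rw [copSeq, ih]
  rcases hwin (fun n => (s n).1.2) fun n => Or.inl (by rw [hseq]; exact hmove (s n)) with
    ⟨i, hi⟩ | ⟨n, i, hi⟩
  · exact notCaught _ _ hv₀ i hi
  · rw [hseq] at hi
    exact hfree (s n) i hi

/-- The cop number of a finite graph is attained. -/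
theorem exists_copsWin_copNumber {n : ℕ} (G : SimpleGraph (Fin n)) (t : ℕ) :
    ∃ CS : CopStrategy G (copNumber G t), CopsWin G t CS := by
  have hne : {k | ∃ CS : CopStrategy G k, CopsWin G t CS}.Nonempty :=
    ⟨n, ⟨id, fun c _ => c, fun _ _ _ => Or.inl rfl⟩, fun r _ => Or.inl ⟨r 0, rfl⟩⟩
  exact Nat.sInf_mem hne

/-! ### The incidence graph of the lines of affine 3-space with directions on a conic -/

namespace ConicGraph

variable {F : Type*} [Field F]

/-- The point `(a, b, c)` lies on the line `[x, y, z]` of direction `(1, x, x²)`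
through `(0, y, z)`. -/
def Inc (p l : F × F × F) : Prop :=
  p.2.1 = p.1 * l.1 + l.2.1 ∧ p.2.2 = p.1 * l.1 ^ 2 + l.2.2

/-- The line of direction `(1, x, x²)` through `v`. -/
def lineAt (v : F × F × F) (x : F) : F × F × F :=
  (x, v.2.1 - v.1 * x, v.2.2 - v.1 * x ^ 2)

/-- The translate of `v` by `s • (1, x, x²)`. -/
def shift (v : F × F × F) (xs : F × F) : F × F × F :=
  (v.1 + xs.2, v.2.1 + xs.2 * xs.1, v.2.2 + xs.2 * xs.1 ^ 2)

theorem inc_lineAt (v : F × F × F) (x : F) : Inc v (lineAt v x) := by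
  constructor <;> simp [lineAt]

theorem inc_shift_lineAt (v : F × F × F) (xs : F × F) : Inc (shift v xs) (lineAt v xs.1) := by
  constructor <;> simp [lineAt, shift] <;> ring

theorem eq_of_inc_of_fst_eq {p p' l : F × F × F} (h : Inc p l) (h' : Inc p' l)
    (h1 : p.1 = p'.1) : p = p' := by
  refine Prod.ext h1 (Prod.ext ?_ ?_)
  · rw [h.1, h'.1, h1]
  · rw [h.2, h'.2, h1]

theorem eq_shift_of_inc {w u l : F × F × F} (hw : Inc w l) (hu : Inc u l) :
    u = shift w (l.1, u.1 - w.1) := by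
  obtain ⟨h1, h2⟩ := hw
  obtain ⟨h1', h2'⟩ := hu
  refine Prod.ext ?_ (Prod.ext ?_ ?_) <;> simp only [shift]
  · ring
  · rw [h1, h1']; ring
  · rw [h2, h2']; ring

theorem shift_injOn (v : F × F × F) : Set.InjOn (shift v) {xs | xs.2 ≠ 0} := by
  rintro ⟨x, s⟩ hs ⟨x', s'⟩ - h
  simp only [shift, Prod.mk.injEq, add_right_inj] at h
  obtain ⟨rfl, h, -⟩ := h
  rw [mul_left_cancel₀ hs h]

theorem shift_ne (v : F × F × F) {xs : F × F} (hs : xs.2 ≠ 0) : v ≠ shift v xs := by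
  intro h
  have := congrArg Prod.fst h
  simp [shift, hs] at this

/-- There are no triangles: a line not through `v` has at most one point collinear
with `v`. -/
theorem eq_of_inc_shift {v l : F × F × F} {xs xs' : F × F} (hs : xs.2 ≠ 0) (hs' : xs'.2 ≠ 0)
    (h : Inc (shift v xs) l) (h' : Inc (shift v xs') l) (hl : l ≠ lineAt v xs.1) :
    xs = xs' := by
  obtain ⟨a, b, c⟩ := v
  obtain ⟨X, Y, Z⟩ := l
  obtain ⟨x, s⟩ := xs
  obtain ⟨x', s'⟩ := xs'
  simp only [Inc, shift, lineAt, ne_eq, Prod.mk.injEq] at *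
  obtain ⟨h1, h2⟩ := h
  obtain ⟨h1', h2'⟩ := h'
  have hX : X - x ≠ 0 := by
    intro hX
    obtain rfl : X = x := sub_eq_zero.mp hX
    exact hl ⟨rfl, by linear_combination -h1, by linear_combination -h2⟩
  have hx : x = x' := by
    have : s * (X - x) * (x - x') = 0 := by
      linear_combination (X + x') * (h1 - h1') - (h2 - h2')
    rcases mul_eq_zero.mp this with h | h
    · exact absurd h (mul_ne_zero hs hX)
    · exact sub_eq_zero.mp h
  subst hx
  refine ⟨rfl, mul_right_cancel₀ hX ?_⟩
  linear_combination h1' - h1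

/-- Vertices of the padded incidence graph: points, lines, and `e` pendant vertices. -/
abbrev Vert (F : Type*) (e : ℕ) := (F × F × F) ⊕ (F × F × F) ⊕ Fin e

/-- The incidence graph with `e` pendant vertices attached to the line `[0, 0, 0]`. -/
def graph (F : Type*) [Field F] (e : ℕ) : SimpleGraph (Vert F e) :=
  SimpleGraph.fromRel fun
    | .inl p, .inr (.inl l) => Inc p l
    | .inr (.inr _), .inr (.inl l) => l = 0
    | _, _ => False

variable {e : ℕ}

theorem adj_point_line {p l : F × F × F} (h : Inc p l) :
    (graph F e).Adj (.inl p) (.inr (.inl l)) := by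
  simp [graph, h]

theorem adj_pendant_line (j : Fin e) : (graph F e).Adj (.inr (.inr j)) (.inr (.inl 0)) := by
  simp [graph]

theorem reachable_shift (v : F × F × F) (xs : F × F) :
    (graph F e).Reachable (.inl v) (.inl (shift v xs)) :=
  (adj_point_line (inc_lineAt v xs.1)).reachable.trans
    (adj_point_line (inc_shift_lineAt v xs)).reachable.symm

theorem connected (h2 : (2 : F) ≠ 0) : (graph F e).Connected := by
  have hpt : ∀ p : F × F × F, (graph F e).Reachable (.inl 0) (.inl p) := by
    rintro ⟨a, b, c⟩
    have h := ((reachable_shift (e := e) (0 : F × F × F) (0, a - c)).trans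
      (reachable_shift _ (1, (c + b) / 2))).trans (reachable_shift _ (-1, (c - b) / 2))
    convert h using 2
    simp only [shift, Prod.fst_zero, Prod.snd_zero, Prod.mk.injEq]
    refine ⟨?_, ?_, ?_⟩ <;> field_simp <;> ring
  have hline : ∀ l : F × F × F, (graph F e).Reachable (.inl 0) (.inr (.inl l)) := fun l =>
    (hpt (0, l.2)).trans (adj_point_line (by simp [Inc])).reachable
  rw [SimpleGraph.connected_iff_exists_forall_reachable]
  refine ⟨.inl 0, ?_⟩
  rintro (p | l | j)
  · exact hpt p
  · exact hline l
  · exact (hline 0).trans (adj_pendant_line j).symm.reachable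

/-- A cop at the given vertex could catch a robber at the point `u` in at most one move. -/
def Near : Vert F e → F × F × F → Prop
  | .inl p, u => p = u
  | .inr (.inl l), u => Inc u l
  | .inr (.inr _), _ => False

/-- A cop at the given vertex could catch a robber at the point `u` in at most two moves. -/
def Near₂ : Vert F e → F × F × F → Prop
  | .inl p, u => ∃ l, Inc p l ∧ Inc u l
  | .inr (.inl l), u => Inc u l
  | .inr (.inr _), u => Inc u 0

theorem near_of_move_to_point {w : Vert F e} {v : F × F × F}
    (h : .inl v = w ∨ (graph F e).Adj w (.inl v)) : Near w v := by
  rcases w with p | l | j <;> simp_all [graph, Near]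

theorem near₂_of_move {w w' : Vert F e} {v : F × F × F}
    (h : w' = w ∨ (graph F e).Adj w w') (hn : Near w' v) : Near₂ w v := by
  rcases w' with p | l | j
  · obtain rfl : p = v := hn
    have := near_of_move_to_point h
    rcases w with p' | l | j
    · obtain rfl : p' = p := this
      exact ⟨_, inc_lineAt p' 0, inc_lineAt p' 0⟩
    · exact this
    · exact this.elim
  · rcases w with p' | l' | j
    · exact ⟨l, by simpa [graph] using h, hn⟩
    · obtain rfl : l = l' := by simpa [graph] using h
      exact hn
    · obtain rfl : l = 0 := by simpa [graph] using h
      exact hn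
  · exact hn.elim

section Counting

variable [Fintype F]

open Finset

open Classical in
/-- Near a cop on neither the robber's vertex nor the line she uses there is at most
one of the points she can reach. -/
theorem card_near_le (w : Vert F e) (v : F × F × F) :
    #{xs : F × F | xs.2 ≠ 0 ∧ w ≠ .inr (.inl (lineAt v xs.1)) ∧ Near w (shift v xs)} ≤ 1 := by
  rw [card_le_one]
  intro xs h xs' h'
  simp only [mem_filter, mem_univ, true_and] at h h'
  obtain ⟨hs, hl, hn⟩ := h
  obtain ⟨hs', -, hn'⟩ := h'
  rcases w with p | l | j
  · exact shift_injOn v hs hs' (hn.symm.trans hn')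
  · exact eq_of_inc_shift hs hs' hn hn' fun h => hl (by rw [h])
  · exact hn.elim

open Classical in
theorem card_inc_shift_le (v l : F × F × F) :
    #{xs : F × F | xs.2 ≠ 0 ∧ Inc (shift v xs) l} ≤ Fintype.card F := by
  refine card_le_card_of_injOn Prod.snd (fun _ _ => mem_univ _) ?_
  intro xs h xs' h' hs
  simp only [coe_filter, mem_univ, true_and, Set.mem_ofPred_eq] at h h'
  exact shift_injOn v h.1 h'.1 (eq_of_inc_of_fst_eq h.2 h'.2 (by simp [shift, hs]))

open Classical in
/-- Two distinct points have few common collinear points. -/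
theorem card_collinear_le {v w : F × F × F} (hw : w ≠ v) :
    #{xs : F × F | xs.2 ≠ 0 ∧ ∃ l, Inc w l ∧ Inc (shift v xs) l} ≤ 2 * Fintype.card F := by
  set S : Finset (F × F) := {xs | xs.2 ≠ 0 ∧ ∃ l, Inc w l ∧ Inc (shift v xs) l} with hS
  rw [← card_filter_add_card_filter_not (s := S) (fun xs => Inc w (lineAt v xs.1)), two_mul]
  refine add_le_add ?_ ?_
  · refine card_le_card_of_injOn Prod.snd (fun _ _ => mem_univ _) ?_
    intro xs h xs' h' hs
    simp only [hS, coe_filter, mem_filter, mem_univ, true_and, Set.mem_ofPred_eq] at h h'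
    refine Prod.ext ?_ hs
    obtain ⟨a, b, c⟩ := v
    obtain ⟨a', b', c'⟩ := w
    obtain ⟨h1, h2⟩ := h.2
    obtain ⟨h1', h2'⟩ := h'.2
    simp only [lineAt] at h1 h2 h1' h2'
    have ha : a' - a ≠ 0 := by
      intro ha
      obtain rfl : a' = a := sub_eq_zero.mp ha
      exact hw (by simp [h1, h2])
    refine mul_left_cancel₀ ha ?_
    linear_combination h1' - h1
  · refine card_le_card_of_injOn Prod.fst (fun _ _ => mem_univ _) ?_
    rintro ⟨x, s⟩ h ⟨x', s'⟩ h' hx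
    obtain rfl : x = x' := hx
    simp only [hS, coe_filter, mem_filter, mem_univ, true_and, Set.mem_ofPred_eq] at h h'
    obtain ⟨⟨hs, l, hwl, hul⟩, hn⟩ := h
    obtain ⟨⟨hs', l', hwl', hul'⟩, -⟩ := h'
    have hne : ∀ {s l}, Inc w l → Inc (shift v (x, s)) l → (shift v (x, s)).1 - w.1 ≠ 0 := by
      intro s l hw hu h
      refine hn ?_
      rw [← eq_of_inc_of_fst_eq hu hw (sub_eq_zero.mp h)]
      exact inc_shift_lineAt v (x, s)
    have h := eq_of_inc_shift (l := lineAt v x) (hne hwl hul) (hne hwl' hul')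
      (by rw [← eq_shift_of_inc hwl hul]; exact inc_shift_lineAt v (x, s))
      (by rw [← eq_shift_of_inc hwl' hul']; exact inc_shift_lineAt v (x, s'))
      (fun h => hn (h ▸ inc_lineAt w _))
    simpa [shift] using congrArg Prod.snd h

open Classical in
theorem card_near₂_le {w : Vert F e} {v : F × F × F} (hw : w ≠ .inl v) :
    #{xs : F × F | xs.2 ≠ 0 ∧ Near₂ w (shift v xs)} ≤ 2 * Fintype.card F := by
  rcases w with p | l | j
  · refine (card_le_card fun xs h => ?_).trans
      (card_collinear_le fun h => hw (congrArg Sum.inl h))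
    rw [mem_filter] at h ⊢
    exact h
  · refine (card_le_card fun xs h => ?_).trans
      ((card_inc_shift_le v l).trans (Nat.le_mul_of_pos_left _ two_pos))
    rw [mem_filter] at h ⊢
    exact h
  · refine (card_le_card fun xs h => ?_).trans
      ((card_inc_shift_le v 0).trans (Nat.le_mul_of_pos_left _ two_pos))
    rw [mem_filter] at h ⊢
    exact h

open Classical in
/-- The robber's invariant: no cop is near, and fewer than `m` cops could become near. -/
def Safe {k : ℕ} (m : ℕ) (c : Fin k → Vert F e) (v : F × F × F) : Prop :=
  (∀ i, ¬ Near (c i) v) ∧ #{i | Near₂ (c i) v} < m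

open Classical in
theorem card_occupied_le {k : ℕ} (c : Fin k → Vert F e) (v : F × F × F) :
    #{x : F | ∃ i, c i = .inr (.inl (lineAt v x))} ≤ #{i | Near (c i) v} := by
  let dir : Vert F e → F := fun w => w.elim (fun _ => 0) (Sum.elim Prod.fst fun _ => 0)
  refine (card_le_card ?_).trans (card_image_le (f := fun i => dir (c i)))
  intro x hx
  obtain ⟨i, hi⟩ := by simpa using hx
  simp only [mem_image, mem_filter, mem_univ, true_and]
  refine ⟨i, ?_, by simp [dir, hi, lineAt]⟩
  rw [hi]
  exact inc_lineAt v x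

open Classical in
/-- If fewer than half of the lines at `v` are near cops, the robber at `v` has a safe
point to move to. -/
theorem exists_safe_shift {k m : ℕ} (hm : Fintype.card F + 1 = 2 * m) (h3 : 3 ≤ Fintype.card F)
    (hk : 15 * k < Fintype.card F ^ 2) (c : Fin k → Vert F e) (v : F × F × F)
    (hv : ∀ i, c i ≠ .inl v) (hnear : #{i | Near (c i) v} < m) :
    ∃ xs : F × F, xs.2 ≠ 0 ∧ (∀ i, c i ≠ .inr (.inl (lineAt v xs.1))) ∧
      Safe m c (shift v xs) := by
  by_contra! hcon
  set q := Fintype.card F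
  let A : Finset (F × F) := ({x : F | ∃ i, c i = .inr (.inl (lineAt v x))} : Finset F) ×ˢ
    ({s : F | s ≠ 0} : Finset F)
  let B : Finset (F × F) := univ.biUnion fun i =>
    {xs : F × F | xs.2 ≠ 0 ∧ c i ≠ .inr (.inl (lineAt v xs.1)) ∧ Near (c i) (shift v xs)}
  let C : Finset (F × F) := {xs : F × F | xs.2 ≠ 0 ∧ m ≤ #{i | Near₂ (c i) (shift v xs)}}
  have hs0 : #{s : F | s ≠ 0} = q - 1 := by
    rw [filter_ne' univ (0 : F), card_erase_of_mem (mem_univ _), card_univ]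
  have hA : #A ≤ (m - 1) * (q - 1) := by
    rw [card_product, hs0]
    exact Nat.mul_le_mul_right _ ((card_occupied_le c v).trans (by omega))
  have hB : #B ≤ k := by
    simpa using card_biUnion_le_card_mul univ _ 1 fun i _ => card_near_le (c i) v
  have hC : #C * m ≤ k * (2 * q) := by
    simpa using card_mul_le_card_mul (s := C) (t := (univ : Finset (Fin k)))
      (fun xs i => Near₂ (c i) (shift v xs))
      (fun xs hxs => (mem_filter.mp hxs).2.2)
      (fun i _ => (card_le_card (by
        intro xs hxs
        simp only [bipartiteBelow, C, mem_filter, mem_univ, true_and] at hxs ⊢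
        exact ⟨hxs.1.1, hxs.2⟩)).trans (card_near₂_le (hv i)))
  have hcover : (univ : Finset F) ×ˢ ({s : F | s ≠ 0} : Finset F) ⊆ A ∪ B ∪ C := by
    intro xs hxs
    have hs : xs.2 ≠ 0 := by simpa using hxs
    simp only [mem_union, A, B, C, mem_product, mem_biUnion, mem_filter, mem_univ, true_and]
    by_cases h1 : ∃ i, c i = .inr (.inl (lineAt v xs.1))
    · exact Or.inl (Or.inl ⟨h1, hs⟩)
    push Not at h1
    by_cases h2 : ∃ i, Near (c i) (shift v xs)
    · obtain ⟨i, hi⟩ := h2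
      exact Or.inl (Or.inr ⟨i, hs, h1 i, hi⟩)
    push Not at h2
    refine Or.inr ⟨hs, ?_⟩
    by_contra! h
    exact hcon xs hs h1 ⟨h2, h⟩
  have hcard : q * (q - 1) ≤ #A + #B + #C := by
    have := (card_le_card hcover).trans ((card_union_le _ _).trans
      (Nat.add_le_add_right (card_union_le _ _) _))
    rwa [card_product, hs0, card_univ] at this
  obtain ⟨d, rfl⟩ : ∃ d, m = d + 1 := ⟨m - 1, by omega⟩
  have hqd : q = 2 * d + 1 := by omega
  rw [hqd] at hcard hA hC hk
  simp only [Nat.add_sub_cancel] at hcard hA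
  have hd : 1 ≤ d := by omega
  nlinarith

open Classical in
theorem exists_safe {k m : ℕ} (hm : Fintype.card F + 1 = 2 * m) (h3 : 3 ≤ Fintype.card F)
    (hk : 15 * k < Fintype.card F ^ 2) (c : Fin k → Vert F e) : ∃ v, Safe m c v := by
  obtain ⟨yz, hyz⟩ : ∃ yz : F × F, ∀ i, ¬ Near (c i) (0, yz) := by
    by_contra! hcon
    choose f hf using hcon
    have hinj : Function.Injective f := by
      intro y y' h
      have h1 := hf y
      have h2 := hf y'
      rw [← h] at h2
      rcases hw : c (f y) with p | l | j
      · rw [hw] at h1 h2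
        exact congrArg Prod.snd (h1.symm.trans h2)
      · rw [hw] at h1 h2
        exact congrArg Prod.snd (eq_of_inc_of_fst_eq h1 h2 rfl)
      · rw [hw] at h1
        exact h1.elim
    have := Fintype.card_le_of_injective f hinj
    rw [Fintype.card_prod, Fintype.card_fin] at this
    nlinarith
  obtain ⟨xs, -, -, h⟩ := exists_safe_shift hm h3 hk c (0, yz)
    (fun i hi => hyz i (by rw [hi]; rfl)) (by
      rw [filter_false_of_mem fun i _ => hyz i, card_empty]
      omega)
  exact ⟨_, h⟩

/-- Fewer than `q² / 15` cops cannot catch a robber of speed at least two on (a copy of)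
the padded incidence graph. -/
theorem not_copsWin {k t : ℕ} (ht : 2 ≤ t) (hodd : Odd (Fintype.card F))
    (h3 : 3 ≤ Fintype.card F) (hk : 15 * k < Fintype.card F ^ 2) (φ : V ≃ Vert F e)
    (CS : CopStrategy ((graph F e).comap φ) k) : ¬ CopsWin ((graph F e).comap φ) t CS := by
  classical
  obtain ⟨d, hd⟩ := hodd
  have hm : Fintype.card F + 1 = 2 * (d + 1) := by omega
  refine not_copsWin_of_invariant ht
    (fun c r => ∃ v, φ r = .inl v ∧ Safe (d + 1) (fun i => φ (c i)) v) ?_ ?_ ?_ CS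
  · intro c
    obtain ⟨v, hv⟩ := exists_safe hm h3 hk fun i => φ (c i)
    exact ⟨φ.symm (.inl v), v, by simp, hv⟩
  · rintro c r ⟨v, hr, hv⟩ i rfl
    exact hv.1 i (by simp [hr, Near])
  · rintro c c' r ⟨v, hr, hv⟩ hmove
    have hmove' : ∀ i, φ (c' i) = φ (c i) ∨ (graph F e).Adj (φ (c i)) (φ (c' i)) := fun i =>
      (hmove i).imp_left (congrArg φ)
    have hfree : ∀ i, φ (c' i) ≠ .inl v := fun i hi =>
      hv.1 i (near_of_move_to_point (by rw [← hi]; exact hmove' i))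
    obtain ⟨xs, hs, hline, hsafe⟩ := exists_safe_shift hm h3 hk (fun i => φ (c' i)) v hfree
      ((card_le_card fun i hi => by
        simp only [mem_filter, mem_univ, true_and] at hi ⊢
        exact near₂_of_move (hmove' i) hi).trans_lt hv.2)
    refine ⟨fun i hi => hfree i (by rw [hi, hr]), φ.symm (.inr (.inl (lineAt v xs.1))),
      φ.symm (.inl (shift v xs)), ?_, ?_, ?_, ?_, shift v xs, by simp, hsafe⟩
    · simpa [hr] using adj_point_line (inc_lineAt v xs.1)
    · simpa using (adj_point_line (inc_shift_lineAt v xs)).symm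
    · rintro rfl
      exact shift_ne v hs (by simpa using hr.symm)
    · rintro i hi
      exact hline i (by simp [hi])

end Counting

end ConicGraph

/-- Every `n ≥ 54` admits an odd prime `p` with `2 p³ ≤ n ≤ 16 p³`. -/
theorem exists_odd_prime_cube_bounds {n : ℕ} (hn : 54 ≤ n) :
    ∃ p, p.Prime ∧ 3 ≤ p ∧ 2 * p ^ 3 ≤ n ∧ n ≤ 16 * p ^ 3 := by
  obtain ⟨M, hM, hM', h3⟩ : ∃ M, 2 * M ^ 3 ≤ n ∧ n < 2 * (M + 1) ^ 3 ∧ 3 ≤ M := by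
    let P := fun M => 2 * M ^ 3 ≤ n
    have h3 : P 3 := by simpa [P] using hn
    have hb : 3 ≤ n := by omega
    refine ⟨Nat.findGreatest P n, Nat.findGreatest_spec hb h3, ?_, Nat.le_findGreatest hb h3⟩
    by_contra! h
    have hle : Nat.findGreatest P n + 1 ≤ n := by
      refine le_trans ?_ h
      nlinarith [Nat.le_self_pow (n := 3) (by norm_num) (Nat.findGreatest P n + 1)]
    exact absurd (Nat.le_findGreatest (P := P) hle h) (by omega)
  obtain ⟨p, hp, hp3, hpM, hMp⟩ : ∃ p, p.Prime ∧ 3 ≤ p ∧ p ≤ M ∧ M + 1 ≤ 2 * p := by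
    rcases h3.eq_or_lt with rfl | h4
    · exact ⟨3, Nat.prime_three, le_rfl, le_rfl, by norm_num⟩
    · obtain ⟨p, hp, h1, h2⟩ := Nat.exists_prime_lt_and_le_two_mul (M / 2) (by omega)
      exact ⟨p, hp, by omega, by omega, by omega⟩
  refine ⟨p, hp, hp3, le_trans (by gcongr) hM, hM'.le.trans ?_⟩
  calc 2 * (M + 1) ^ 3 ≤ 2 * (2 * p) ^ 3 := by gcongr
    _ = 16 * p ^ 3 := by ring

/-- For a fixed robber speed `t ≥ 2` there is a constant `c > 0` such that
for every `n ≥ 54` there is a connected graph on exactly `n` vertices whose speed-`t`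
cop number is at least `c·n^(2/3)`. -/
theorem stmt2 (t : ℕ) (ht : 2 ≤ t) :
    ∃ c : ℝ, 0 < c ∧
      ∀ n : ℕ, 54 ≤ n →
        ∃ G : SimpleGraph (Fin n), G.Connected ∧
          c * (n : ℝ) ^ ((2 : ℝ) / 3) ≤ (copNumber G t : ℝ) := by
  refine ⟨1 / (15 * (16 : ℝ) ^ ((2 : ℝ) / 3)), by positivity, fun n hn => ?_⟩
  obtain ⟨p, hp, hp3, hpn, hnp⟩ := exists_odd_prime_cube_bounds hn
  have : Fact p.Prime := ⟨hp⟩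
  obtain ⟨e, rfl⟩ := Nat.exists_eq_add_of_le hpn
  have hcard : Fintype.card (ConicGraph.Vert (ZMod p) e) = 2 * p ^ 3 + e := by
    simp [ZMod.card]
    ring
  let φ : Fin (2 * p ^ 3 + e) ≃ ConicGraph.Vert (ZMod p) e :=
    (Fintype.equivFinOfCardEq hcard).symm
  have hodd : Odd p := hp.odd_of_ne_two (by omega)
  have h2 : (2 : ZMod p) ≠ 0 := by
    intro h
    have := (ZMod.natCast_eq_zero_iff 2 p).mp (by exact_mod_cast h)
    exact absurd (Nat.le_of_dvd (by norm_num) this) (by omega)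
  refine ⟨(ConicGraph.graph (ZMod p) e).comap φ,
    (SimpleGraph.Iso.comap φ _).connected_iff.mpr (ConicGraph.connected h2), ?_⟩
  obtain ⟨CS, hCS⟩ := exists_copsWin_copNumber ((ConicGraph.graph (ZMod p) e).comap φ) t
  generalize copNumber ((ConicGraph.graph (ZMod p) e).comap φ) t = N at CS hCS ⊢
  have hN : p ^ 2 ≤ 15 * N := by
    by_contra! h
    exact ConicGraph.not_copsWin ht (by rwa [ZMod.card]) (by rwa [ZMod.card])
      (by rwa [ZMod.card]) φ CS hCS
  have hpow : ((2 * p ^ 3 + e : ℕ) : ℝ) ^ ((2 : ℝ) / 3) ≤ (16 : ℝ) ^ ((2 : ℝ) / 3) * p ^ 2 := by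
    calc ((2 * p ^ 3 + e : ℕ) : ℝ) ^ ((2 : ℝ) / 3)
        ≤ (16 * (p : ℝ) ^ 3) ^ ((2 : ℝ) / 3) :=
          Real.rpow_le_rpow (by positivity) (by exact_mod_cast hnp) (by norm_num)
      _ = (16 : ℝ) ^ ((2 : ℝ) / 3) * p ^ 2 := by
          rw [Real.mul_rpow (by norm_num) (by positivity), ← Real.rpow_natCast (p : ℝ) 3,
            ← Real.rpow_mul (by positivity)]
          norm_num
  have hN' : (p : ℝ) ^ 2 ≤ 15 * N := by exact_mod_cast hN
  have h16 : (0 : ℝ) < (16 : ℝ) ^ ((2 : ℝ) / 3) := by positivity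
  rw [div_mul_eq_mul_div, one_mul, div_le_iff₀ (by positivity)]
  nlinarith
end

section
/- Every vertex of G lies on at most t(d+1)^{t−1} + (d+1)^t escaping paths; moreover, every vertex of G that does not belong to S lies on at most t(d+1)^{t−1} escaping paths. -/
open SimpleGraph

variable {V : Type*}

/-- The set `U` of all vertices lying on some path of length `t` from `r` to a vertex of `S`. -/
def pathUnion (G : SimpleGraph V) (t : ℕ) (r : V) (S : Set V) : Set V :=
  {v | ∃ s ∈ S, ∃ w : G.Walk r s, w.IsPath ∧ w.length = t ∧ v ∈ w.support}

/-- An *escaping path* (encoded by its two endpoints together with the walk joining them)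
is a path of length `t` whose first vertex lies in `S` and whose second vertex lies
outside `U`. -/
def IsEscapingPath (G : SimpleGraph V) (t : ℕ) (S U : Set V)
    (p : Σ u : V, Σ v : V, G.Walk u v) : Prop :=
  p.2.2.IsPath ∧ p.2.2.length = t ∧ p.1 ∈ S ∧ p.2.2.getVert 1 ∉ U

namespace SimpleGraph

/-- Two paths with the same endpoints coincide if their total length is less than the girth. -/
theorem Walk.IsPath.eq_of_length_add_lt_girth {G : SimpleGraph V} {u v : V} {p q : G.Walk u v}
    (hp : p.IsPath) (hq : q.IsPath) (h : p.length + q.length < G.girth) : p = q := by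
  by_contra hne
  let H : SimpleGraph V := fromEdgeSet {e | e ∈ p.edges ++ q.edges}
  have hHG : H ≤ G := by
    intro a b hab
    obtain ⟨hab, -⟩ := (fromEdgeSet_adj _).1 hab
    rcases List.mem_append.1 hab with hab | hab
    · exact p.adj_of_mem_edges hab
    · exact q.adj_of_mem_edges hab
  have hmem : ∀ e ∈ p.edges ++ q.edges, e ∈ G.edgeSet → e ∈ H.edgeSet := by
    intro e he heG
    rw [edgeSet_fromEdgeSet]
    exact ⟨he, G.not_isDiag_of_mem_edgeSet heG⟩
  have hpH : ∀ e ∈ p.edges, e ∈ H.edgeSet := fun e he ↦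
    hmem e (List.mem_append_left _ he) (p.edges_subset_edgeSet he)
  have hqH : ∀ e ∈ q.edges, e ∈ H.edgeSet := fun e he ↦
    hmem e (List.mem_append_right _ he) (q.edges_subset_edgeSet he)
  have hcyc : ¬ H.IsAcyclic := by
    intro hac
    have heq := congrArg Subtype.val ((hac.subsingleton_path u v).elim
      ⟨p.transfer H hpH, hp.transfer hpH⟩ ⟨q.transfer H hqH, hq.transfer hqH⟩)
    apply hne
    apply Walk.ext_support
    simpa using congrArg Walk.support heq
  obtain ⟨a, c, hc⟩ : ∃ (a : V) (c : H.Walk a a), c.IsCycle := by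
    simpa [IsAcyclic] using hcyc
  have hlen : c.edges.length ≤ (p.edges ++ q.edges).length := by
    refine (hc.edges_nodup.subperm fun e he ↦ ?_).length_le
    have heH := c.edges_subset_edgeSet he
    rw [edgeSet_fromEdgeSet] at heH
    exact heH.1
  have hgirth := girth_le_length (hc.mapLe hHG)
  simp at hlen hgirth
  omega

/-- A walk is determined, together with its endpoints, by its support. -/
theorem Walk.sigma_support_injective (G : SimpleGraph V) :
    Function.Injective fun p : Σ u : V, Σ x : V, G.Walk u x ↦ p.2.2.support := by
  rintro ⟨u, x, w⟩ ⟨u', x', w'⟩ h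
  dsimp only at h
  obtain rfl : u = u' := by
    rw [← w.head_support, ← w'.head_support]
    simp only [h]
  obtain rfl : x = x' := by
    rw [← w.getLast_support, ← w'.getLast_support]
    simp only [h]
  rw [Walk.ext_support h]

/-- The vertex sequences of walks with `n` vertices whose vertex of index `i` is `v`. -/
def chainsThrough (G : SimpleGraph V) (n i : ℕ) (v : V) : Set (List V) :=
  {l | l.length = n ∧ l.IsChain G.Adj ∧ l[i]? = some v}

theorem finite_chainsThrough [Finite V] (G : SimpleGraph V) (n i : ℕ) (v : V) :
    (G.chainsThrough n i v).Finite :=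
  (List.finite_length_eq V n).subset fun _ hl ↦ hl.1

theorem ncard_chainsThrough_succ_le [Fintype V] (G : SimpleGraph V) [DecidableRel G.Adj] {D : ℕ}
    (hreg : G.IsRegularOfDegree D) (n i : ℕ) (v : V) :
    (G.chainsThrough (n + 2) (i + 1) v).ncard ≤ D * (G.chainsThrough (n + 1) i v).ncard := by
  classical
  have hfin := G.finite_chainsThrough (n + 2) (i + 1) v
  have hfin' := G.finite_chainsThrough (n + 1) i v
  rw [Set.ncard_eq_toFinset_card _ hfin, Set.ncard_eq_toFinset_card _ hfin']
  refine Finset.card_le_mul_card_image_of_maps_to (f := List.tail) ?_ D ?_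
  · intro l hl
    rw [Set.Finite.mem_toFinset] at hl ⊢
    obtain ⟨hlen, hchain, hv⟩ := hl
    exact ⟨by simp [hlen], hchain.tail, by simpa using hv⟩
  · intro m hm
    rw [Set.Finite.mem_toFinset] at hm
    obtain ⟨b, m, rfl⟩ := List.exists_cons_of_length_eq_add_one hm.1
    rw [← hreg b, ← G.card_neighborFinset_eq_degree b]
    refine (Finset.card_le_card (t := (G.neighborFinset b).image (· :: b :: m)) ?_).trans
      Finset.card_image_le
    intro l hl
    rw [Finset.mem_filter, Set.Finite.mem_toFinset] at hl
    obtain ⟨⟨hlen, hchain, -⟩, htail⟩ := hl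
    obtain ⟨a, l, rfl⟩ := List.exists_cons_of_length_eq_add_one hlen
    obtain rfl : l = b :: m := htail
    rw [List.isChain_cons_cons] at hchain
    exact Finset.mem_image.2 ⟨a, by simpa using hchain.1.symm, rfl⟩

theorem ncard_chainsThrough_le [Fintype V] (G : SimpleGraph V) [DecidableRel G.Adj] {D : ℕ}
    (hreg : G.IsRegularOfDegree D) (n i : ℕ) (v : V) :
    (G.chainsThrough (n + 1) i v).ncard ≤ D ^ n := by
  induction n generalizing i with
  | zero =>
    rw [pow_zero, Set.ncard_le_one_iff (G.finite_chainsThrough _ _ v)]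
    rintro l m ⟨hl, -, hlv⟩ ⟨hm, -, hmv⟩
    obtain ⟨a, rfl⟩ := List.length_eq_one_iff.1 hl
    obtain ⟨b, rfl⟩ := List.length_eq_one_iff.1 hm
    cases i <;> simp_all
  | succ n ih =>
    have hsucc (i : ℕ) : (G.chainsThrough (n + 2) (i + 1) v).ncard ≤ D ^ (n + 1) := by
      rw [pow_succ']
      exact (G.ncard_chainsThrough_succ_le hreg n i v).trans (Nat.mul_le_mul_left D (ih i))
    cases i with
    | succ i => exact hsucc i
    | zero =>
      refine le_trans (Set.ncard_le_ncard_of_injOn List.reverse ?_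
        List.reverse_injective.injOn (G.finite_chainsThrough _ _ v)) (hsucc n)
      rintro l ⟨hlen, hchain, hv⟩
      refine ⟨by simp [hlen], ?_, ?_⟩
      · rw [List.isChain_reverse]
        exact hchain.imp fun _ _ h ↦ h.symm
      · rw [List.getElem?_reverse (by omega)]
        simpa [hlen] using hv

end SimpleGraph

/-- A vertex outside `U` has at most one neighbour in `S`. -/
theorem eq_of_adj_of_notMem_pathUnion {G : SimpleGraph V} {t : ℕ} (ht : 0 < t)
    (hgirth : 2 * t + 2 < G.girth) {r : V} {S : Set V} (hS : ∀ s ∈ S, G.dist r s = t)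
    {x s s' : V} (hx : x ∉ pathUnion G t r S) (hs : s ∈ S) (hs' : s' ∈ S)
    (hadj : G.Adj s x) (hadj' : G.Adj s' x) : s = s' := by
  have key : ∀ y ∈ S, ∃ q : G.Walk r y, q.IsPath ∧ q.length = t ∧ x ∉ q.support := by
    intro y hy
    obtain ⟨q, hq⟩ := exists_walk_of_dist_ne_zero (by rw [hS y hy]; exact ht.ne')
    have hpath := q.isPath_of_length_eq_dist hq
    rw [hS y hy] at hq
    exact ⟨q, hpath, hq, fun hmem ↦ hx ⟨y, hy, q, hpath, hq, hmem⟩⟩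
  obtain ⟨q, hq, hlen, hxq⟩ := key s hs
  obtain ⟨q', hq', hlen', hxq'⟩ := key s' hs'
  have heq := (hq.concat hxq hadj).eq_of_length_add_lt_girth (hq'.concat hxq' hadj')
    (by simp only [Walk.length_concat]; omega)
  exact (Walk.concat_inj heq).1

/-- The escaping paths whose vertex of index `i` is `v`. -/
def escapingPathsAt (G : SimpleGraph V) (t : ℕ) (S U : Set V) (i : ℕ) (v : V) :
    Set (Σ u : V, Σ x : V, G.Walk u x) :=
  {p | IsEscapingPath G t S U p ∧ p.2.2.support[i]? = some v}

theorem mapsTo_support_escapingPathsAt (G : SimpleGraph V) (t : ℕ) (S U : Set V) (i : ℕ) (v : V) :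
    Set.MapsTo (fun p ↦ p.2.2.support) (escapingPathsAt G t S U i v)
      (G.chainsThrough (t + 1) i v) := by
  rintro ⟨u, x, w⟩ ⟨⟨-, hlen, -, -⟩, hv⟩
  exact ⟨by simpa using hlen, w.isChain_adj_support, hv⟩

theorem finite_escapingPathsAt [Finite V] (G : SimpleGraph V) (t : ℕ) (S U : Set V) (i : ℕ)
    (v : V) : (escapingPathsAt G t S U i v).Finite :=
  Set.Finite.of_injOn (mapsTo_support_escapingPathsAt G t S U i v)
    (Walk.sigma_support_injective G).injOn (G.finite_chainsThrough _ _ v)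

theorem ncard_escapingPathsAt_le [Fintype V] (G : SimpleGraph V) [DecidableRel G.Adj] {D : ℕ}
    (hreg : G.IsRegularOfDegree D) (t : ℕ) (S U : Set V) (i : ℕ) (v : V) :
    (escapingPathsAt G t S U i v).ncard ≤ D ^ t :=
  (Set.ncard_le_ncard_of_injOn _ (mapsTo_support_escapingPathsAt G t S U i v)
    (Walk.sigma_support_injective G).injOn (G.finite_chainsThrough _ _ v)).trans
    (G.ncard_chainsThrough_le hreg t i v)

theorem ncard_escapingPathsAt_succ_le [Fintype V] {G : SimpleGraph V} [DecidableRel G.Adj]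
    {D t : ℕ} (hreg : G.IsRegularOfDegree D) (ht : 0 < t) (hgirth : 2 * t + 2 < G.girth)
    {r : V} {S : Set V} (hS : ∀ s ∈ S, G.dist r s = t) (i : ℕ) (v : V) :
    (escapingPathsAt G t S (pathUnion G t r S) (i + 1) v).ncard ≤ D ^ (t - 1) := by
  refine le_trans (Set.ncard_le_ncard_of_injOn (fun p ↦ p.2.2.support.tail) ?_ ?_
    (G.finite_chainsThrough (t - 1 + 1) i v)) (G.ncard_chainsThrough_le hreg (t - 1) i v)
  · rintro ⟨u, x, w⟩ hw
    obtain ⟨hlen, hchain, hv⟩ := mapsTo_support_escapingPathsAt G t S _ (i + 1) v hw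
    refine ⟨?_, hchain.tail, by simpa using hv⟩
    simp only [List.length_tail] at hlen ⊢
    omega
  · rintro ⟨u, x, w⟩ ⟨⟨-, hlen, hu, hesc⟩, -⟩ ⟨u', x', w'⟩ ⟨⟨-, hlen', hu', -⟩, -⟩ htail
    dsimp only at *
    apply Walk.sigma_support_injective G
    dsimp only
    cases w with
    | nil => simp at hlen; omega
    | cons h w =>
      cases w' with
      | nil => simp at hlen'; omega
      | cons h' w' =>
        simp only [Walk.support_cons, List.tail_cons] at htail ⊢
        have hhead := w.head_support
        simp only [htail, Walk.head_support] at hhead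
        subst hhead
        rw [htail, eq_of_adj_of_notMem_pathUnion ht hgirth hS (by simpa using hesc) hu hu' h h']

/-- Every vertex lies on at most `t(d+1)^(t-1) + (d+1)^t` escaping paths,
and every vertex not in `S` lies on at most `t(d+1)^(t-1)` escaping paths. -/
theorem stmt5 {V : Type*} [Fintype V] (t d : ℕ) (ht : 0 < t) (hd : 0 < d)
    (G : SimpleGraph V) [DecidableRel G.Adj]
    (hreg : G.IsRegularOfDegree (d + 1)) (hgirth : (2 * t + 2 : ℕ∞) < G.girth)
    (r : V) (S : Set V) (hS : ∀ s ∈ S, G.dist r s = t)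
    (U : Set V) (hU : U = pathUnion G t r S) (v : V) :
    {p : Σ u : V, Σ x : V, G.Walk u x |
        IsEscapingPath G t S U p ∧ v ∈ p.2.2.support}.ncard
          ≤ t * (d + 1) ^ (t - 1) + (d + 1) ^ t ∧
    (v ∉ S →
      {p : Σ u : V, Σ x : V, G.Walk u x |
          IsEscapingPath G t S U p ∧ v ∈ p.2.2.support}.ncard ≤ t * (d + 1) ^ (t - 1)) := by
  subst hU
  replace hgirth : 2 * t + 2 < G.girth := by exact_mod_cast hgirth
  set U := pathUnion G t r S
  set later := ⋃ i ∈ Finset.range t, escapingPathsAt G t S U (i + 1) v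
  have hlater_fin : later.Finite :=
    (Finset.range t).finite_toSet.biUnion fun i _ ↦ finite_escapingPathsAt G t S U (i + 1) v
  have hlater_card : later.ncard ≤ t * (d + 1) ^ (t - 1) := by
    refine (Finset.set_ncard_biUnion_le _ _).trans ?_
    refine (Finset.sum_le_card_nsmul _ _ ((d + 1) ^ (t - 1)) fun i _ ↦
      ncard_escapingPathsAt_succ_le hreg ht hgirth hS i v).trans ?_
    simp
  have hcover : ∀ p : Σ u : V, Σ x : V, G.Walk u x,
      IsEscapingPath G t S U p ∧ v ∈ p.2.2.support →
        p ∈ later ∨ p ∈ escapingPathsAt G t S U 0 v := by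
    rintro p ⟨hp, hv⟩
    obtain ⟨i, hi, hiv⟩ := List.mem_iff_getElem.1 hv
    have hiv' : p.2.2.support[i]? = some v := by rw [List.getElem?_eq_getElem hi, hiv]
    cases i with
    | zero => exact Or.inr ⟨hp, hiv'⟩
    | succ i =>
      rw [Walk.length_support, hp.2.1] at hi
      exact Or.inl (Set.mem_biUnion (Finset.mem_coe.2 (Finset.mem_range.2 (by omega))) ⟨hp, hiv'⟩)
  constructor
  · refine (Set.ncard_le_ncard hcover
      (hlater_fin.union (finite_escapingPathsAt G t S U 0 v))).trans ?_
    exact (Set.ncard_union_le _ _).trans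
      (Nat.add_le_add hlater_card (ncard_escapingPathsAt_le G hreg t S U 0 v))
  · intro hvS
    refine (Set.ncard_le_ncard (fun p hp ↦ (hcover p hp).resolve_right ?_) hlater_fin).trans
      hlater_card
    rintro ⟨⟨-, -, hs, -⟩, hv⟩
    apply hvS
    rw [List.getElem?_eq_getElem (by simp), Walk.support_getElem_zero, Option.some.injEq] at hv
    rwa [← hv]
end
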